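/- arXiv:1105.4722 — 2 statements merged into one kernel-verified Lean document; each statement's English description precedes it below -/
import Mathlib

section
/- Fix integers ℓ ≥ 1, N_s ≥ 1, L = ℓN_s, parameters η, ξ₁,…,ξ_{N_s} ∈ ℂ with q = e^η satisfying q^{2m} ≠ 1 for 1 ≤ m ≤ ℓ, and set the inhomogeneities equal to the complete ℓ-strings w_j = w^{(ℓ)}_j. Let λ ∈ ℂ satisfy sinh(λ − w^{(ℓ)}_j + η) ≠ 0 for all 1 ≤ j ≤ L (i.e., λ avoids w^{(ℓ)}_j − η modulo πi). Then the full spin-ℓ/2 projector P^{(ℓ)}_{1…L} satisfies P^{(ℓ)}_{1…L} X(λ) P^{(ℓ)}_{1…L} = P^{(ℓ)}_{1…L} X(λ) for each of the four monodromy-matrix entries X ∈ {A, B, C, D} of the homogeneous-grading monodromy matrix T^{(ℓ+;0)}(λ); equivalently P^{(ℓ)}_{1…L} T^{(ℓ+;0)}(λ) P^{(ℓ)}_{1…L} = P^{(ℓ)}_{1…L} T^{(ℓ+;0)}(λ) on ℂ²_0 ⊗ (ℂ²)^{⊗L}. -/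
noncomputable section

/-- The q-integer `[n]_q = (qⁿ − q⁻ⁿ)/(q − q⁻¹)`. -/
def qint (q : ℂ) (n : ℕ) : ℂ := (q ^ (n : ℤ) - q ^ (-(n : ℤ))) / (q - q⁻¹)

/-- The q-factorial `[n]_q! = ∏_{m=1}^n [m]_q`. -/
def qfact (q : ℂ) (n : ℕ) : ℂ := ∏ m ∈ Finset.range n, qint q (m + 1)

/-- The q-binomial coefficient `[l choose n]_q`. -/
def qbinom (q : ℂ) (l n : ℕ) : ℂ := qfact q l / (qfact q (l - n) * qfact q n)
/-- Index of the standard basis of `(ℂ²)^{⊗l}`: spin configurations `{0,1}^l`. -/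
abbrev SpinIdx (l : ℕ) := Fin l → Fin 2

/-- Vectors in `(ℂ²)^{⊗l}`. -/
abbrev SpinVec (l : ℕ) := SpinIdx l → ℂ

/-- Operators (matrices) on `(ℂ²)^{⊗l}`. -/
abbrev SpinOp (l : ℕ) := Matrix (SpinIdx l) (SpinIdx l) ℂ

/-- The indicator configuration of a subset `A`: down spins exactly on `A`. -/
def indFun {l : ℕ} (A : Finset (Fin l)) : SpinIdx l := fun k => if k ∈ A then 1 else 0

/-- The standard basis vector `|1_A⟩` with down spins exactly on `A`. -/
def bvec {l : ℕ} (A : Finset (Fin l)) : SpinVec l := fun ε => if ε = indFun A then 1 else 0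

/-- `Σ_{a ∈ A} a`, where the site `k : Fin l` has 1-based number `k+1 ∈ {1,…,l}`. -/
def siteSum {l : ℕ} (A : Finset (Fin l)) : ℤ := ∑ a ∈ A, ((a : ℤ) + 1)

/-- Coefficient `q^{(Σ_{a∈A} a) − i·l + i(i−1)/2}`. -/
def hwt (q : ℂ) {l : ℕ} (i : ℕ) (A : Finset (Fin l)) : ℂ :=
  q ^ (siteSum A - (i : ℤ) * (l : ℤ) + (i : ℤ) * ((i : ℤ) - 1) / 2)

/-- The spin-`l/2` basis vector `||l,i⟩`. -/
def hv (q : ℂ) (l i : ℕ) : SpinVec l :=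
  ∑ A ∈ Finset.powersetCard i (Finset.univ : Finset (Fin l)), hwt q i A • bvec A

/-- The conjugate covector `⟨l,j||` (represented by its coefficient vector; the pairing
is the bilinear transpose pairing). -/
def cv (q : ℂ) (l j : ℕ) : SpinVec l :=
  ((qbinom q l j)⁻¹ * q ^ ((j : ℤ) * ((l : ℤ) - (j : ℤ)))) •
    ∑ B ∈ Finset.powersetCard j (Finset.univ : Finset (Fin l)), hwt q j B • bvec B

/-- The rank-one operator `|u⟩⟨v|` (transpose pairing). -/
def rankOne {l : ℕ} (u v : SpinVec l) : SpinOp l := Matrix.of fun ε ε' => u ε * v ε'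

/-- The spin-`l/2` projector `P^{(l)} = Σ_{n=0}^{l} ||l,n⟩⟨l,n||`. -/
def proj (q : ℂ) (l : ℕ) : SpinOp l :=
  ∑ n ∈ Finset.range (l + 1), rankOne (hv q l n) (cv q l n)

/-- The elementary operator `e_k^{a,b}` acting on the k-th tensor factor. -/
def elem {l : ℕ} (k : Fin l) (a b : Fin 2) : SpinOp l :=
  Matrix.of fun ε ε' => if ε k = a ∧ ε' k = b ∧ ∀ m, m ≠ k → ε m = ε' m then 1 else 0

/-- The ordered product `e_1^{e'_1,e_1} ⋯ e_l^{e'_l,e_l}`. -/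
def elemProd {l : ℕ} (e' e : Fin l → Fin 2) : SpinOp l :=
  (List.ofFn fun k : Fin l => elem k (e' k) (e k)).prod

/-- The gauge matrix `⊗_s diag(1, e^{w s})`. -/
def gaugeM {S : Type*} [Fintype S] [DecidableEq S] (w : S → ℂ) :
    Matrix (S → Fin 2) (S → Fin 2) ℂ :=
  Matrix.diagonal fun ε => ∏ s, if ε s = 1 then Complex.exp (w s) else 1
/-- Sites of the chain of `Ns` blocks of `l` spin-1/2 sites: block `b`, position `β`
(1-based site number `l·b + β + 1`; lexicographic order is the site order). -/
abbrev FSite (l Ns : ℕ) := Fin Ns × Fin l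

/-- Spin configurations of the full chain `(ℂ²)^{⊗(l·Ns)}`. -/
abbrev FIdx2 (l Ns : ℕ) := FSite l Ns → Fin 2

/-- Operators on the full chain. -/
abbrev FOp (l Ns : ℕ) := Matrix (FIdx2 l Ns) (FIdx2 l Ns) ℂ

/-- Embed an operator on one block of `l` factors into the full chain (block `b`,
identity elsewhere). -/
def embed {l Ns : ℕ} (b : Fin Ns) (M : SpinOp l) : FOp l Ns :=
  Matrix.of fun ε ε' =>
    if ∀ s : FSite l Ns, s.1 ≠ b → ε s = ε' s then
      M (fun β => ε (b, β)) (fun β => ε' (b, β)) else 0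

/-- The complete `l`-string inhomogeneities `w^{(l)}_{l(b−1)+β} = ξ_b − (β−1)η`. -/
def wstring (l Ns : ℕ) (η : ℂ) (ξ : Fin Ns → ℂ) : FSite l Ns → ℂ :=
  fun s => ξ s.1 - (s.2.val : ℂ) * η

/-- The full projector `P^{(l)}_{1…L} = ⊗_{b=1}^{Ns} P^{(l)}` (one per block). -/
def projFull (q : ℂ) (l Ns : ℕ) : FOp l Ns :=
  Matrix.of fun ε ε' => ∏ b : Fin Ns, proj q l (fun β => ε (b, β)) (fun β => ε' (b, β))

/-- The normalization `F(l,n) = [l choose n]_q q^{−n(l−n)}`. -/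
def Fnorm (q : ℂ) (l n : ℕ) : ℂ := qbinom q l n * q ^ (-(n : ℤ) * ((l : ℤ) - (n : ℤ)))

/-- The normalization factor `N̂_{i,j} = (g(j)/g(i))·(F(l,i)/F(l,j))·e^{η(i(l−i)−j(l−j))/2}`. -/
def Nhat (q η : ℂ) (g : ℕ → ℂ) (l i j : ℕ) : ℂ :=
  (g j / g i) * (Fnorm q l i / Fnorm q l j) *
    Complex.exp (η * (((i : ℂ) * ((l : ℂ) - (i : ℂ)) - (j : ℂ) * ((l : ℂ) - (j : ℂ))) / 2))
/-- `b(u) = sinh u / sinh(u+η)`. -/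
def bC (η u : ℂ) : ℂ := Complex.sinh u / Complex.sinh (u + η)

/-- `c⁺(u) = e^{u} sinh η / sinh(u+η)`. -/
def cP (η u : ℂ) : ℂ := Complex.exp u * Complex.sinh η / Complex.sinh (u + η)

/-- `c⁻(u) = e^{−u} sinh η / sinh(u+η)`. -/
def cM (η u : ℂ) : ℂ := Complex.exp (-u) * Complex.sinh η / Complex.sinh (u + η)

/-- The homogeneous-grading R-matrix `R⁺(u)` on `ℂ² ⊗ ℂ²`: identity on `|00⟩`, `|11⟩`,
and `[[b, c⁻],[c⁺, b]]` on `span{|01⟩, |10⟩}`. -/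
def Rplus (η u : ℂ) : Matrix (Fin 2 × Fin 2) (Fin 2 × Fin 2) ℂ :=
  Matrix.of fun p p' =>
    if p = p' then (if p.1 = p.2 then 1 else bC η u)
    else if p.1 = 0 ∧ p.2 = 1 ∧ p'.1 = 1 ∧ p'.2 = 0 then cM η u
    else if p.1 = 1 ∧ p.2 = 0 ∧ p'.1 = 0 ∧ p'.2 = 1 then cP η u
    else 0

/-- The principal-grading (symmetric) R-matrix `R^p(u)`: identity on `|00⟩`, `|11⟩`,
and `[[b, c],[c, b]]` on `span{|01⟩, |10⟩}` with `c(u) = sinh η / sinh(u+η)`. -/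
def Rprin (η u : ℂ) : Matrix (Fin 2 × Fin 2) (Fin 2 × Fin 2) ℂ :=
  Matrix.of fun p p' =>
    if p = p' then (if p.1 = p.2 then 1 else bC η u)
    else if (p.1 = 0 ∧ p.2 = 1 ∧ p'.1 = 1 ∧ p'.2 = 0) ∨
            (p.1 = 1 ∧ p.2 = 0 ∧ p'.1 = 0 ∧ p'.2 = 1) then
      Complex.sinh η / Complex.sinh (u + η)
    else 0

/-- A 4×4 R-matrix acting on the pair (auxiliary space 0, quantum site j), identity on
the other sites. -/
def Rsite {S : Type*} [DecidableEq S] [Fintype S]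
    (R2 : Matrix (Fin 2 × Fin 2) (Fin 2 × Fin 2) ℂ) (j : S) :
    Matrix (Fin 2 × (S → Fin 2)) (Fin 2 × (S → Fin 2)) ℂ :=
  Matrix.of fun p p' =>
    if ∀ k, k ≠ j → p.2 k = p'.2 k then R2 (p.1, p.2 j) (p'.1, p'.2 j) else 0

/-- The monodromy matrix `T(λ) = R_{0,L}(λ−w_L) ⋯ R_{0,1}(λ−w_1)`, where `sites` lists
the sites `1,…,L` in increasing order. -/
def monodromy {S : Type*} [DecidableEq S] [Fintype S]
    (R2 : ℂ → Matrix (Fin 2 × Fin 2) (Fin 2 × Fin 2) ℂ)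
    (sites : List S) (w : S → ℂ) (lam : ℂ) :
    Matrix (Fin 2 × (S → Fin 2)) (Fin 2 × (S → Fin 2)) ℂ :=
  ((sites.map fun j => Rsite (R2 (lam - w j)) j).reverse).prod

/-- The auxiliary-space block entry of a monodromy matrix: `T_{a,b}` acting on the
quantum space (so `A = T_{0,0}`, `B = T_{0,1}`, `C = T_{1,0}`, `D = T_{1,1}`). -/
def entryT {S : Type*} (T : Matrix (Fin 2 × (S → Fin 2)) (Fin 2 × (S → Fin 2)) ℂ)
    (a b : Fin 2) : Matrix (S → Fin 2) (S → Fin 2) ℂ :=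
  Matrix.of fun ε ε' => T (a, ε) (b, ε')

/-- The number of down spins of a configuration. -/
def dcount {S : Type*} [Fintype S] [DecidableEq S] (ε : S → Fin 2) : ℕ :=
  (Finset.univ.filter fun s => ε s = 1).card

/-- The list of sites of the blocked chain in increasing (lexicographic) order. -/
def sitesList (l Ns : ℕ) : List (Fin Ns × Fin l) :=
  (List.finRange Ns).flatMap fun b => (List.finRange l).map fun β => (b, β)

section helpers

def upd2 {S : Type*} [DecidableEq S] (ε : S → Fin 2) (i j : S) (s t : Fin 2) : S → Fin 2 :=
  Function.update (Function.update ε i s) j t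

def Good {S : Type*} [DecidableEq S] (q : ℂ) (i j : S) (v : Fin 2 × (S → Fin 2) → ℂ) : Prop :=
  ∀ a ε, v (a, upd2 ε i j 0 1) = q * v (a, upd2 ε i j 1 0)

lemma vecMul_Rsite {S : Type*} [DecidableEq S] [Fintype S]
    (R2 : Matrix (Fin 2 × Fin 2) (Fin 2 × Fin 2) ℂ) (j : S)
    (v : Fin 2 × (S → Fin 2) → ℂ) (a' : Fin 2) (ε' : S → Fin 2) :
    (Matrix.vecMul v (Rsite R2 j)) (a', ε') =
      ∑ a, ∑ s, v (a, Function.update ε' j s) * R2 (a, s) (a', ε' j) := by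
  simp only [Matrix.vecMul, dotProduct, Fintype.sum_prod_type]
  refine Finset.sum_congr rfl fun a _ => ?_
  symm
  refine Finset.sum_of_injOn (fun s => Function.update ε' j s) ?_ ?_ ?_ ?_
  · intro s _ t _ h
    exact Function.update_injective ε' j h
  · intro s _; simp
  · intro ε _ hε
    simp only [Rsite, Matrix.of_apply]
    rw [if_neg, mul_zero]
    intro h
    apply hε
    refine ⟨ε j, by simp, ?_⟩
    funext k
    by_cases hk : k = j
    · subst hk; simp
    · simp [hk, h k hk]
  · intro s _
    simp only [Rsite, Matrix.of_apply]
    rw [if_pos]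
    · simp
    · intro k hk; simp [hk]

lemma Good.other {S : Type*} [DecidableEq S] [Fintype S] {q : ℂ} {i j : S}
    {v : Fin 2 × (S → Fin 2) → ℂ} (h : Good q i j v)
    (R2 : Matrix (Fin 2 × Fin 2) (Fin 2 × Fin 2) ℂ) (k : S) (hi : k ≠ i) (hj : k ≠ j) :
    Good q i j (Matrix.vecMul v (Rsite R2 k)) := by
  intro a ε
  have hc : ∀ s t r, Function.update (upd2 ε i j s t) k r
      = upd2 (Function.update ε k r) i j s t := by
    intro s t r
    unfold upd2
    rw [Function.update_comm hj.symm, Function.update_comm hi.symm]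
  have hk : ∀ s t, upd2 ε i j s t k = ε k := by
    intro s t; simp [upd2, hi, hj]
  simp only [vecMul_Rsite, hc, hk, Finset.mul_sum, h _ _, mul_assoc]

lemma Good.otherList {S : Type*} [DecidableEq S] [Fintype S] {q : ℂ} {i j : S}
    (R2 : S → Matrix (Fin 2 × Fin 2) (Fin 2 × Fin 2) ℂ) (L : List S) (hi : i ∉ L) (hj : j ∉ L) :
    ∀ {v : Fin 2 × (S → Fin 2) → ℂ} (_ : Good q i j v),
    Good q i j (Matrix.vecMul v (L.map fun k => Rsite (R2 k) k).prod) := by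
  induction L with
  | nil => intro v h; simpa using h
  | cons k L ih =>
    intro v h
    simp only [List.mem_cons, not_or] at hi hj
    rw [List.map_cons, List.prod_cons, ← Matrix.vecMul_vecMul]
    exact ih hi.2 hj.2 (h.other _ k (Ne.symm hi.1) (Ne.symm hj.1))

lemma Good.pair {S : Type*} [DecidableEq S] [Fintype S] {i j : S} (η u : ℂ)
    (h1 : Complex.sinh (u + η) ≠ 0) (h2 : Complex.sinh (u + η + η) ≠ 0)
    {v : Fin 2 × (S → Fin 2) → ℂ} (h : Good (Complex.exp η) i j v) (hij : i ≠ j) :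
    Good (Complex.exp η) i j (Matrix.vecMul (Matrix.vecMul v (Rsite (Rplus η (u + η)) j))
      (Rsite (Rplus η u) i)) := by
  intro a ε
  have hci : ∀ s t r, Function.update (upd2 ε i j s t) i r = upd2 ε i j r t := by
    intro s t r
    unfold upd2
    rw [Function.update_comm hij, Function.update_idem, Function.update_comm hij]
  have hcj : ∀ s t r, Function.update (upd2 ε i j s t) j r = upd2 ε i j s r := by
    intro s t r
    unfold upd2
    rw [Function.update_idem]
  have hi : ∀ s t, upd2 ε i j s t i = s := by
    intro s t; simp [upd2, hij]
  have hj : ∀ s t, upd2 ε i j s t j = t := by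
    intro s t; simp [upd2]
  have e0 := h 0 ε
  have e1 := h 1 ε
  simp only [vecMul_Rsite, hci, hcj, hi, hj, Fin.sum_univ_two, e0, e1]
  have hs : Complex.sinh (u + η) = (Complex.exp u * Complex.exp η
      - (Complex.exp u)⁻¹ * (Complex.exp η)⁻¹) / 2 := by
    rw [Complex.sinh, neg_add, Complex.exp_add, Complex.exp_add, Complex.exp_neg, Complex.exp_neg]
  have hs2 : Complex.sinh (u + η + η) = (Complex.exp u * Complex.exp η * Complex.exp η
      - (Complex.exp u)⁻¹ * (Complex.exp η)⁻¹ * (Complex.exp η)⁻¹) / 2 := by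
    rw [Complex.sinh, neg_add, neg_add]
    simp only [Complex.exp_add, Complex.exp_neg]
  have hx := Complex.exp_ne_zero u
  have hq := Complex.exp_ne_zero η
  have I1 : cP η (u + η) = Complex.exp η * (bC η (u + η) * cP η u) := by
    simp only [cP, bC, Complex.exp_add]
    field_simp
  have I2 : bC η (u + η) = bC η u + Complex.exp η * (cM η (u + η) * cP η u) := by
    simp only [cP, bC, cM]
    field_simp
    rw [hs, hs2]
    simp only [Complex.sinh, Complex.exp_add, Complex.exp_neg, neg_add]
    field_simp
    ring
  have I3 : bC η (u + η) * cM η u = Complex.exp η * cM η (u + η) := by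
    simp only [cM, bC, Complex.exp_add, neg_add, Complex.exp_neg]
    field_simp
  have I4 : Complex.exp η * bC η u + cP η (u + η) * cM η u  = Complex.exp η * bC η (u + η) := by
    simp only [cP, bC, cM]
    field_simp
    rw [hs, hs2]
    simp only [Complex.sinh, Complex.exp_add, Complex.exp_neg, neg_add]
    field_simp
    ring
  fin_cases a
  · simp [Rplus]
    grind
  · simp [Rplus]
    grind

end helpers

section helpers2

lemma sitesList_nodup (l Ns : ℕ) : (sitesList l Ns).Nodup :=
  (List.nodup_finRange Ns).product (List.nodup_finRange l)

lemma finRange_split {l : ℕ} (i j : Fin l) (hij : j.val = i.val + 1) :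
    ∃ A B, List.finRange l = A ++ i :: j :: B := by
  refine ⟨(List.finRange l).take i, (List.finRange l).drop (i + 2), ?_⟩
  conv_lhs => rw [← List.take_append_drop i.val (List.finRange l)]
  congr 1
  rw [List.drop_eq_getElem_cons (by simp), List.drop_eq_getElem_cons (by simp; omega)]
  congr 1
  · simp
  congr 1
  ext
  simp [hij]

lemma sitesList_split {l Ns : ℕ} (b : Fin Ns) (i j : Fin l) (hij : j.val = i.val + 1) :
    ∃ A B, sitesList l Ns = A ++ (b, i) :: (b, j) :: B := by
  obtain ⟨A, B, h⟩ := finRange_split i j hij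
  obtain ⟨A', B', h'⟩ := List.append_of_mem (List.mem_finRange b)
  unfold sitesList
  rw [h', h]
  refine ⟨A'.flatMap (fun b => (A ++ i :: j :: B).map fun β => (b, β)) ++ A.map fun β => (b, β),
    B.map (fun β => (b, β)) ++ B'.flatMap (fun b => (A ++ i :: j :: B).map fun β => (b, β)), ?_⟩
  simp

def expo {S : Type*} [Fintype S] (k : S → ℤ) (ε : S → Fin 2) : ℤ :=
  ∑ s, if ε s = 1 then k s else 0

lemma expo_upd2 {S : Type*} [Fintype S] [DecidableEq S] (k : S → ℤ) (ε : S → Fin 2) (i j : S)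
    (hij : i ≠ j) : expo k (upd2 ε i j 0 1) = expo k (upd2 ε i j 1 0) + k j - k i := by
  have : expo k (upd2 ε i j 0 1) - expo k (upd2 ε i j 1 0) =
      ∑ s, ((if s = j then k s else 0) - (if s = i then k s else 0)) := by
    unfold expo
    rw [← Finset.sum_sub_distrib]
    refine Finset.sum_congr rfl fun s _ => ?_
    by_cases h1 : s = j
    · subst h1; simp [upd2, hij.symm]
    · by_cases h2 : s = i
      · subst h2; simp [upd2, hij]
      · simp [upd2, h1, h2]
  rw [Finset.sum_sub_distrib] at this
  simp at this
  linarith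

lemma dcount_eq_expo {S : Type*} [Fintype S] [DecidableEq S] (ε : S → Fin 2) :
    (dcount ε : ℤ) = expo (fun _ => 1) ε := by
  simp [dcount, expo]

lemma dcount_upd2 {S : Type*} [Fintype S] [DecidableEq S] (ε : S → Fin 2) (i j : S)
    (hij : i ≠ j) : dcount (upd2 ε i j 0 1) = dcount (upd2 ε i j 1 0) := by
  have : (dcount (upd2 ε i j 0 1) : ℤ) = dcount (upd2 ε i j 1 0) := by
    rw [dcount_eq_expo, dcount_eq_expo, expo_upd2 _ _ _ _ hij]; ring
  exact_mod_cast this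

/-- block site weight -/
def kb (l : ℕ) : Fin l → ℤ := fun β => (β : ℤ) + 1

lemma sum_bvec (q : ℂ) (l n : ℕ) (x : SpinIdx l) :
    (∑ A ∈ Finset.powersetCard n (Finset.univ : Finset (Fin l)), hwt q n A • bvec A) x =
      if dcount x = n then
        q ^ (expo (kb l) x - (n : ℤ) * (l : ℤ) + (n : ℤ) * ((n : ℤ) - 1) / 2) else 0 := by
  have hx : ∀ A : Finset (Fin l), x = indFun A ↔ A = Finset.univ.filter (fun s => x s = 1) := by
    intro A
    constructor
    · rintro rfl; ext s; simp [indFun]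
    · rintro rfl; funext s
      simp only [indFun, Finset.mem_filter, Finset.mem_univ, true_and]
      generalize x s = t
      revert t; decide
  simp only [Finset.sum_apply, Pi.smul_apply, bvec, hx, smul_eq_mul, mul_ite, mul_one, mul_zero]
  rw [Finset.sum_ite_eq']
  simp only [Finset.mem_powersetCard, Finset.subset_univ, true_and, dcount]
  simp only [hwt, siteSum, expo, kb, Finset.sum_filter]
  congr

/-- normalisation -/
def Cn (q : ℂ) (l n : ℕ) : ℂ := (qbinom q l n)⁻¹ * q ^ ((n : ℤ) * ((l : ℤ) - (n : ℤ))) *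
  (q ^ (- (n : ℤ) * (l : ℤ) + (n : ℤ) * ((n : ℤ) - 1) / 2)) ^ 2

lemma dcount_le {l : ℕ} (x : SpinIdx l) : dcount x ≤ l := by
  unfold dcount
  exact (Finset.card_le_univ _).trans (by simp)

lemma proj_apply' (q : ℂ) (hq : q ≠ 0) (l : ℕ) (x y : SpinIdx l) :
    proj q l x y = if dcount x = dcount y then
      Cn q l (dcount y) * q ^ expo (kb l) x * q ^ expo (kb l) y else 0 := by
  simp only [proj, Matrix.sum_apply, rankOne, Matrix.of_apply, hv, cv, Pi.smul_apply, sum_bvec]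
  simp only [ite_mul, zero_mul]
  rw [Finset.sum_ite_eq, if_pos (by simpa [Nat.lt_succ_iff] using dcount_le x)]
  by_cases h : dcount x = dcount y
  · simp only [h, if_true, smul_eq_mul, Cn]
    have hE : ∀ e a d : ℤ, e - a * l + d = e + (-a * l + d) := by intros; ring
    rw [hE, hE, zpow_add₀ hq, zpow_add₀ hq (expo (kb l) y)]
    ring
  · simp [h, Ne.symm h]

lemma proj_upd2 (q : ℂ) (hq : q ≠ 0) (l : ℕ) (x y : SpinIdx l) (i j : Fin l)
    (hij : j.val = i.val + 1) :
    proj q l x (upd2 y i j 0 1) = q * proj q l x (upd2 y i j 1 0) := by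
  have hne : i ≠ j := by intro h; subst h; omega
  rw [proj_apply' q hq, proj_apply' q hq, dcount_upd2 _ _ _ hne, expo_upd2 _ _ _ _ hne]
  have : kb l j = kb l i + 1 := by simp [kb, hij]
  rw [this, show ∀ a b : ℤ, a + (b + 1) - b = a + 1 by intros; ring, zpow_add_one₀ hq]
  split_ifs <;> ring

/-- generating sum -/
def Ssum (q : ℂ) (l n : ℕ) : ℂ :=
  ∑ x : SpinIdx l, if dcount x = n then (q ^ expo (kb l) x) ^ 2 else 0

lemma Ssum_step (q : ℂ) (hq : q ≠ 0) (l n : ℕ) : Ssum q (l + 1) n =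
    Ssum q l n + ∑ x : SpinIdx l, if dcount x + 1 = n then
      (q ^ expo (kb l) x * q ^ (l + 1)) ^ 2 else 0 := by
  unfold Ssum
  rw [← (Fin.snocEquiv (fun _ : Fin (l + 1) => Fin 2)).sum_comp, Fintype.sum_prod_type,
    Fin.sum_univ_two]
  have hd : ∀ t x, (Fin.snocEquiv (fun _ : Fin (l + 1) => Fin 2)) (t, x) = Fin.snoc x t :=
    fun _ _ => rfl
  have he : ∀ (t : Fin 2) (x : SpinIdx l), expo (kb (l + 1)) (Fin.snoc x t : SpinIdx (l + 1)) =
      expo (kb l) x + if t = 1 then (l + 1 : ℤ) else 0 := by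
    intro t x
    simp [expo, Fin.sum_univ_castSucc, kb]
  have hc : ∀ (t : Fin 2) (x : SpinIdx l), dcount (Fin.snoc x t : SpinIdx (l + 1)) =
      dcount x + if t = 1 then 1 else 0 := by
    intro t x
    have : (dcount (Fin.snoc x t : SpinIdx (l + 1)) : ℤ) =
      dcount x + if t = 1 then 1 else 0 := by
      simp only [dcount_eq_expo]
      simp only [expo, Fin.sum_univ_castSucc, Fin.snoc_castSucc, Fin.snoc_last]
    split_ifs at this ⊢ <;> exact_mod_cast this
  simp only [hd, he, hc]
  congr 1
  · simp
  · simp only [if_true]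
    refine Finset.sum_congr rfl fun x _ => ?_
    rw [zpow_add₀ hq]
    norm_cast

lemma Ssum_zero (q : ℂ) (n : ℕ) : Ssum q 0 n = if n = 0 then 1 else 0 := by
  simp [Ssum, dcount, expo, eq_comm]

lemma Ssum_succ_zero (q : ℂ) (hq : q ≠ 0) (l : ℕ) : Ssum q (l + 1) 0 = Ssum q l 0 := by
  rw [Ssum_step q hq]; simp

lemma Ssum_succ_succ (q : ℂ) (hq : q ≠ 0) (l n : ℕ) :
    Ssum q (l + 1) (n + 1) = Ssum q l (n + 1) + q ^ (2 * (l + 1)) * Ssum q l n := by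
  rw [Ssum_step q hq]
  congr 1
  rw [Ssum, Finset.mul_sum]
  refine Finset.sum_congr rfl fun x _ => ?_
  simp only [add_left_inj, mul_ite, mul_zero]
  split_ifs
  · ring
  · rfl

lemma Ssum_gt (q : ℂ) (l n : ℕ) (h : l < n) : Ssum q l n = 0 := by
  unfold Ssum
  refine Finset.sum_eq_zero fun x _ => ?_
  rw [if_neg]
  have := dcount_le x
  omega

lemma qfact_succ (q : ℂ) (n : ℕ) : qfact q (n + 1) = qfact q n * qint q (n + 1) := by
  simp [qfact, Finset.prod_range_succ]

lemma Ssum_eq (q : ℂ) (hq : q ≠ 0) (l : ℕ) : ∀ n ≤ l,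
    Ssum q l n * (qfact q (l - n) * qfact q n) = q ^ (n * (l + 1)) * qfact q l := by
  induction l with
  | zero => intro n hn; obtain rfl : n = 0 := by omega
            simp [Ssum_zero, qfact]
  | succ l ih =>
    intro n hn
    cases n with
    | zero =>
      rw [Ssum_succ_zero q hq]
      have := ih 0 (by omega)
      simp only [Nat.sub_zero] at this ⊢
      simp [qfact_succ] at this ⊢
      have h0 : qfact q 0 = 1 := by simp [qfact]
      simp only [h0, mul_one] at this ⊢
      rw [← mul_assoc, this]
    | succ n =>
      have key : ∀ a b : ℕ, qint q a + q ^ (a + b) * qint q b = q ^ b * qint q (a + b) := by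
        intro a b
        simp only [qint, zpow_neg, zpow_natCast]
        rw [mul_div_assoc', ← add_div, mul_div_assoc']
        congr 1
        field_simp
        ring
      rw [Ssum_succ_succ q hq]
      have h1 := ih n (by omega)
      rcases Nat.lt_or_ge n l with hlt | hge
      · obtain ⟨d, rfl⟩ : ∃ d, l = n + 1 + d := ⟨l - (n + 1), by omega⟩
        have h2 := ih (n + 1) (by omega)
        have k := key (d + 1) (n + 1)
        rw [show n + 1 + d + 1 - (n + 1) = d + 1 by omega]
        rw [show n + 1 + d - n = d + 1 by omega] at h1
        rw [show n + 1 + d - (n + 1) = d by omega] at h2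
        rw [qfact_succ q (n + 1 + d), show n + 1 + d + 1 = d + 1 + (n + 1) by omega]
        rw [qfact_succ q n] at h2 ⊢
        rw [qfact_succ q d] at h1 ⊢
        linear_combination (qint q (d + 1)) * h2 + q ^ (2 * (d + 1 + (n + 1))) * qint q (n+1) * h1
          + q ^ ((n + 1) * (n + 1 + d + 1)) * qfact q (n + 1 + d) * k
      · obtain rfl : n = l := by omega
        rw [Ssum_gt q n (n + 1) (by omega)]
        simp only [Nat.sub_self] at h1 ⊢
        rw [qfact_succ]
        linear_combination q ^ (2 * (n + 1)) * qint q (n + 1) * h1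

lemma qfact_ne (q : ℂ) (hq : q ≠ 0) (l : ℕ) (hroot : ∀ m : ℕ, 1 ≤ m → m ≤ l → q ^ (2 * m) ≠ 1)
    (n : ℕ) (hn : n ≤ l) : qfact q n ≠ 0 := by
  have key : ∀ m : ℕ, 1 ≤ m → m ≤ l → q ^ m - (q ^ m)⁻¹ ≠ 0 := by
    intro m h1 h2 h
    apply hroot m h1 h2
    have := pow_ne_zero m hq
    field_simp at h
    rw [two_mul, pow_add]
    linear_combination h
  unfold qfact
  rw [Finset.prod_ne_zero_iff]
  intro m hm
  have hm' := Finset.mem_range.1 hm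
  unfold qint
  rw [zpow_neg, zpow_natCast]
  have := key 1 le_rfl (by omega)
  rw [pow_one] at this
  exact div_ne_zero (key (m + 1) (by omega) (by omega)) this

lemma Cn_Ssum (q : ℂ) (hq : q ≠ 0) (l : ℕ) (hroot : ∀ m : ℕ, 1 ≤ m → m ≤ l → q ^ (2 * m) ≠ 1)
    (n : ℕ) (hn : n ≤ l) : Cn q l n * Ssum q l n = 1 := by
  have h := Ssum_eq q hq l n hn
  have n1 := qfact_ne q hq l hroot n hn
  have n2 := qfact_ne q hq l hroot (l - n) (by omega)
  have n3 := qfact_ne q hq l hroot l le_rfl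
  have hS : Ssum q l n = q ^ ((n * (l + 1) : ℕ) : ℤ) * qbinom q l n := by
    rw [qbinom, zpow_natCast, mul_div_assoc', ← h]
    field_simp
  have hb : qbinom q l n ≠ 0 := div_ne_zero n3 (mul_ne_zero n2 n1)
  have he : (q ^ (- (n : ℤ) * (l : ℤ) + (n : ℤ) * ((n : ℤ) - 1) / 2)) ^ 2
      = q ^ (-2 * (n : ℤ) * l + n * (n - 1)) := by
    rw [← zpow_natCast, ← zpow_mul]
    congr 1
    have : (2 : ℤ) ∣ n * (n - 1) := by
      rcases Int.even_mul_pred_self (n : ℤ) with ⟨r, hr⟩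
      exact ⟨r, by linarith⟩
    push_cast
    have := Int.ediv_mul_cancel this
    linarith
  rw [hS, Cn, he]
  calc _ = ((qbinom q l n)⁻¹ * qbinom q l n) * (q ^ ((n : ℤ) * ((l : ℤ) - (n : ℤ))) *
        q ^ (-2 * (n : ℤ) * l + n * (n - 1)) * q ^ ((n * (l + 1) : ℕ) : ℤ)) := by ring
    _ = 1 := by
      rw [inv_mul_cancel₀ hb, ← zpow_add₀ hq, ← zpow_add₀ hq, one_mul]
      have : (n : ℤ) * ((l : ℤ) - (n : ℤ)) + (-2 * (n : ℤ) * l + n * (n - 1))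
        + ((n * (l + 1) : ℕ) : ℤ) = 0 := by push_cast; ring
      rw [this, zpow_zero]

end helpers2

section helpers3

lemma Good.inv {l Ns : ℕ} {q : ℂ} (hq : q ≠ 0) {v : Fin 2 × FIdx2 l Ns → ℂ}
    (h : ∀ (b : Fin Ns) (i j : Fin l), j.val = i.val + 1 → Good q (b, i) (b, j) v)
    (a : Fin 2) (ε ε' : FIdx2 l Ns)
    (hd : ∀ b, dcount (fun β => ε (b, β)) = dcount (fun β => ε' (b, β))) :
    v (a, ε) * q ^ expo (fun s => kb l s.2) ε' = v (a, ε') * q ^ expo (fun s => kb l s.2) ε := by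
  set G : FIdx2 l Ns → ℂ := fun ε => v (a, ε) / q ^ expo (fun s => kb l s.2) ε with hG
  suffices hh : G ε = G ε' by
    simp only [hG] at hh
    rw [div_eq_div_iff (zpow_ne_zero _ hq) (zpow_ne_zero _ hq)] at hh
    exact hh
  have hG2 : ∀ (b : Fin Ns) (i j : Fin l), j.val = i.val + 1 → ∀ ε,
      G (upd2 ε (b, i) (b, j) 0 1) = G (upd2 ε (b, i) (b, j) 1 0) := by
    intro b i j hij ε
    have hne : ((b, i) : FSite l Ns) ≠ (b, j) := by
      intro h; simp only [Prod.mk.injEq, true_and] at h; subst h; omega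
    simp only [hG]
    rw [h b i j hij, expo_upd2 _ _ _ _ hne]
    have : kb l j = kb l i + 1 := by simp [kb, hij]
    simp only [this]
    rw [show ∀ a b : ℤ, a + (b + 1) - b = a + 1 by intros; ring, zpow_add_one₀ hq]
    have := zpow_ne_zero (expo (fun s : FSite l Ns => kb l s.2) (upd2 ε (b, i) (b, j) 1 0)) hq
    field_simp
  let H : Submonoid (Equiv.Perm (FSite l Ns)) :=
    { carrier := {π | ∀ x, G (x ∘ π) = G x}
      one_mem' := fun x => rfl
      mul_mem' := by
        intro π ρ h1 h2 x
        have := h2 (x ∘ π)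
        rw [h1 x] at this
        exact this }
  have hswap : ∀ (b : Fin Ns) (i j : Fin l), j.val = i.val + 1 →
      Equiv.swap (b, i) (b, j) ∈ H := by
    intro b i j hij x
    have hne : ((b, i) : FSite l Ns) ≠ (b, j) := by
      intro h; simp only [Prod.mk.injEq, true_and] at h; subst h; omega
    have hcomp : x ∘ Equiv.swap (b, i) (b, j) = upd2 x (b, i) (b, j) (x (b, j)) (x (b, i)) := by
      funext s
      by_cases h1 : s = (b, j)
      · subst h1; simp [upd2]
      · by_cases h2 : s = (b, i)
        · subst h2; simp [upd2, h1]
        · simp [upd2, h1, h2, Equiv.swap_apply_of_ne_of_ne h2 h1]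
    have hself : x = upd2 x (b, i) (b, j) (x (b, i)) (x (b, j)) := by
      simp [upd2]
    rw [hcomp]
    conv_rhs => rw [hself]
    have h2 := hG2 b i j hij x
    generalize x (b, i) = s
    generalize x (b, j) = t
    fin_cases s <;> fin_cases t
    · rfl
    · exact h2.symm
    · exact h2
    · rfl
  have hext : ∀ (b : Fin Ns) (σ : Equiv.Perm (Fin l)), Equiv.Perm.prodExtendRight b σ ∈ H := by
    intro b σ
    cases l with
    | zero =>
      have : Equiv.Perm.prodExtendRight b σ = 1 := by
        ext s; exact s.2.elim0
        exact s.2.elim0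
      rw [this]; exact H.one_mem
    | succ l =>
      have hσ : σ ∈ Submonoid.closure
          (Set.range fun i : Fin l => Equiv.swap i.castSucc i.succ) := by
        rw [Equiv.Perm.mclosure_swap_castSucc_succ]; trivial
      induction hσ using Submonoid.closure_induction with
      | mem x hx =>
        obtain ⟨i, rfl⟩ := hx
        have := hswap b i.castSucc i.succ (by simp)
        convert this using 1
        refine Equiv.ext fun s => ?_
        obtain ⟨b', β⟩ := s
        by_cases hb : b' = b
        · subst hb
          simp only [Equiv.Perm.prodExtendRight_apply_eq, Equiv.swap_apply_def, Prod.mk.injEq,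
            true_and]
          split_ifs <;> rfl
        · rw [Equiv.Perm.prodExtendRight_apply_ne _ hb, Equiv.swap_apply_of_ne_of_ne] <;>
          simp [hb]
      | one =>
        have : Equiv.Perm.prodExtendRight b (1 : Equiv.Perm (Fin (l + 1))) = 1 := by
          refine Equiv.ext fun s => ?_
          obtain ⟨b', β⟩ := s
          by_cases hb : b' = b
          · subst hb; simp
          · rw [Equiv.Perm.prodExtendRight_apply_ne _ hb]; simp
        rw [this]; exact H.one_mem
      | mul x y _ _ hx hy =>
        have : Equiv.Perm.prodExtendRight b (x * y) =
            Equiv.Perm.prodExtendRight b x * Equiv.Perm.prodExtendRight b y := by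
          refine Equiv.ext fun s => ?_
          obtain ⟨b', β⟩ := s
          by_cases hb : b' = b
          · subst hb; simp
          · simp [Equiv.Perm.prodExtendRight_apply_ne _ hb]
        rw [this]; exact H.mul_mem hx hy
  have hσ : ∀ b, ∃ σ : Equiv.Perm (Fin l), ∀ β, ε (b, σ β) = ε' (b, β) := by
    intro b
    have hcard : Fintype.card {β // ε' (b, β) = 1} = Fintype.card {β // ε (b, β) = 1} := by
      rw [Fintype.card_subtype, Fintype.card_subtype]
      exact (hd b).symm
    let e := Fintype.equivOfCardEq hcard
    refine ⟨e.extendSubtype, fun β => ?_⟩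
    by_cases h1 : ε' (b, β) = 1
    · rw [h1]; exact e.extendSubtype_mem β h1
    · have := e.extendSubtype_not_mem β h1
      revert this h1
      generalize ε' (b, β) = s
      generalize ε (b, e.extendSubtype β) = t
      revert s t; decide
  choose σ hσ using hσ
  have hall : Equiv.prodCongrRight σ ∈ H := by
    rw [← Equiv.Perm.prod_prodExtendRight σ (List.nodup_finRange Ns) (List.mem_finRange)]
    refine H.list_prod_mem ?_
    intro x hx
    obtain ⟨b, _, rfl⟩ := List.mem_map.1 hx
    exact hext b _
  rw [← hall ε]
  congr 1
  funext s
  exact hσ s.1 s.2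

lemma projFull_row_good {l Ns : ℕ} {q : ℂ} (hq : q ≠ 0) (c : Fin 2) (δ : FIdx2 l Ns)
    (b : Fin Ns) (i j : Fin l) (hij : j.val = i.val + 1) :
    Good q (b, i) (b, j) (fun p : Fin 2 × FIdx2 l Ns =>
      (if c = p.1 then (1 : ℂ) else 0) * projFull q l Ns δ p.2) := by
  intro a ε
  simp only [projFull, Matrix.of_apply]
  rw [← Finset.mul_prod_erase _ _ (Finset.mem_univ b),
    ← Finset.mul_prod_erase _ _ (Finset.mem_univ b)]
  have hb : ∀ s t, (fun β => upd2 ε (b, i) (b, j) s t (b, β)) =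
      upd2 (fun β => ε (b, β)) i j s t := by
    intro s t; funext β
    simp [upd2, Function.update_apply]
  have hb' : ∀ s t, ∀ x ∈ Finset.univ.erase b,
      proj q l (fun β => δ (x, β)) (fun β => upd2 ε (b, i) (b, j) s t (x, β)) =
      proj q l (fun β => δ (x, β)) (fun β => ε (x, β)) := by
    intro s t x hx
    have hx' := Finset.ne_of_mem_erase hx
    congr 1; funext β
    simp [upd2, Function.update_apply, hx']
  rw [hb, hb, Finset.prod_congr rfl (hb' 0 1), Finset.prod_congr rfl (hb' 1 0),
    proj_upd2 q hq l _ _ i j hij]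
  ring

lemma Good.fixed {l Ns : ℕ} {q : ℂ} (hq : q ≠ 0)
    (hroot : ∀ m : ℕ, 1 ≤ m → m ≤ l → q ^ (2 * m) ≠ 1) {v : Fin 2 × FIdx2 l Ns → ℂ}
    (h : ∀ (b : Fin Ns) (i j : Fin l), j.val = i.val + 1 → Good q (b, i) (b, j) v)
    (a : Fin 2) (ε' : FIdx2 l Ns) :
    ∑ ε, v (a, ε) * projFull q l Ns ε ε' = v (a, ε') := by
  have hexp : ∀ ε : FIdx2 l Ns, q ^ expo (fun s => kb l s.2) ε =
      ∏ b, q ^ expo (kb l) (fun β => ε (b, β)) := by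
    intro ε
    rw [expo, Fintype.sum_prod_type]
    have hs : ∀ f : Fin Ns → ℤ, q ^ (∑ b, f b) = ∏ b, q ^ f b := by
      intro f
      induction (Finset.univ : Finset (Fin Ns)) using Finset.induction_on with
      | empty => simp
      | insert x s hx ih => rw [Finset.sum_insert hx, Finset.prod_insert hx, zpow_add₀ hq, ih]
    rw [hs]
    rfl
  have hterm : ∀ ε : FIdx2 l Ns, v (a, ε) * projFull q l Ns ε ε' = v (a, ε') *
      ∏ b, (fun (b : Fin Ns) (x : SpinIdx l) => if dcount x = dcount (fun β => ε' (b, β)) then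
        Cn q l (dcount (fun β => ε' (b, β))) * (q ^ expo (kb l) x) ^ 2 else 0)
        b (fun β => ε (b, β)) := by
    intro ε
    simp only [projFull, Matrix.of_apply, proj_apply' q hq]
    by_cases hd : ∀ b, dcount (fun β => ε (b, β)) = dcount (fun β => ε' (b, β))
    · simp only [hd, if_true]
      have := h
      have hi := Good.inv hq h a ε ε' hd
      rw [hexp, hexp] at hi
      simp only [pow_two, Finset.prod_mul_distrib]
      linear_combination (∏ b, Cn q l (dcount fun β => ε' (b, β))) *
        (∏ b, q ^ expo (kb l) (fun β => ε (b, β))) * hi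
    · push Not at hd
      obtain ⟨b, hb⟩ := hd
      rw [Finset.prod_eq_zero (Finset.mem_univ b) (if_neg hb),
        Finset.prod_eq_zero (Finset.mem_univ b) (if_neg hb)]
      simp
  simp only [hterm]
  rw [← Finset.mul_sum]
  have hcurry := (Equiv.curry (Fin Ns) (Fin l) (Fin 2)).sum_comp (fun e => ∏ b,
    (fun (b : Fin Ns) (x : SpinIdx l) => if dcount x = dcount (fun β => ε' (b, β)) then
        Cn q l (dcount (fun β => ε' (b, β))) * (q ^ expo (kb l) x) ^ 2 else 0) b (e b))
  have hone : ∑ e : Fin Ns → SpinIdx l, ∏ b,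
    (fun (b : Fin Ns) (x : SpinIdx l) => if dcount x = dcount (fun β => ε' (b, β)) then
        Cn q l (dcount (fun β => ε' (b, β))) * (q ^ expo (kb l) x) ^ 2 else 0) b (e b) = 1 := by
    have gen : ∀ f : Fin Ns → SpinIdx l → ℂ,
        ∑ e : Fin Ns → SpinIdx l, ∏ b, f b (e b) = ∏ b, ∑ x, f b x := by
      intro f
      rw [Finset.prod_univ_sum, Fintype.piFinset_univ]
    refine (gen (fun (b : Fin Ns) (x : SpinIdx l) => if dcount x = dcount (fun β => ε' (b, β)) then
        Cn q l (dcount (fun β => ε' (b, β))) * (q ^ expo (kb l) x) ^ 2 else 0)).trans ?_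
    refine Finset.prod_eq_one fun b _ => ?_
    rw [← Cn_Ssum q hq l hroot (dcount (fun β => ε' (b, β))) (dcount_le _), Ssum, Finset.mul_sum]
    refine Finset.sum_congr rfl fun x _ => ?_
    simp only [mul_ite, mul_zero]
  rw [hone] at hcurry
  have : ∀ r : ℂ, r = 1 → v (a, ε') * r = v (a, ε') := by rintro r rfl; ring
  exact this _ hcurry

lemma Good.monodromy {l Ns : ℕ} (η : ℂ) (ξ : Fin Ns → ℂ) (lam : ℂ)
    (hden : ∀ s : FSite l Ns, Complex.sinh (lam - wstring l Ns η ξ s + η) ≠ 0)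
    {v : Fin 2 × FIdx2 l Ns → ℂ} (b : Fin Ns) (i j : Fin l) (hij : j.val = i.val + 1)
    (h : Good (Complex.exp η) (b, i) (b, j) v) :
    Good (Complex.exp η) (b, i) (b, j) (Matrix.vecMul v
      (monodromy (Rplus η) (sitesList l Ns) (wstring l Ns η ξ) lam)) := by
  obtain ⟨A, B, hAB⟩ := sitesList_split (Ns := Ns) b i j hij
  have hnd := sitesList_nodup l Ns
  rw [hAB] at hnd
  unfold _root_.monodromy
  rw [hAB]
  have hne : ((b, i) : FSite l Ns) ≠ (b, j) := by
    intro h; simp only [Prod.mk.injEq, true_and] at h; subst h; omega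
  have hA1 : (b, i) ∉ A := by
    intro hm; exact (List.nodup_append.1 hnd).2.2 _ hm _ (by simp) rfl
  have hA2 : (b, j) ∉ A := by
    intro hm; exact (List.nodup_append.1 hnd).2.2 _ hm _ (by simp) rfl
  have hB := (List.nodup_append.1 hnd).2.1
  simp only [List.nodup_cons, List.mem_cons, not_or] at hB
  have hsplit : (List.map (fun k => Rsite (Rplus η (lam - wstring l Ns η ξ k)) k)
      (A ++ (b, i) :: (b, j) :: B)).reverse.prod =
      (List.map (fun k => Rsite (Rplus η (lam - wstring l Ns η ξ k)) k) B.reverse).prod *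
      Rsite (Rplus η (lam - wstring l Ns η ξ (b, j))) (b, j) *
      Rsite (Rplus η (lam - wstring l Ns η ξ (b, i))) (b, i) *
      (List.map (fun k => Rsite (Rplus η (lam - wstring l Ns η ξ k)) k) A.reverse).prod := by
    simp [mul_assoc]
  have hw : lam - wstring l Ns η ξ (b, j) = lam - wstring l Ns η ξ (b, i) + η := by
    simp only [wstring, hij]; push_cast; ring
  rw [hsplit, ← Matrix.vecMul_vecMul, ← Matrix.vecMul_vecMul, ← Matrix.vecMul_vecMul]
  refine Good.otherList (fun k => Rplus η (lam - wstring l Ns η ξ k)) A.reverse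
    (by simpa using hA1) (by simpa using hA2) ?_
  have h2 := hden (b, j)
  rw [hw] at h2 ⊢
  refine Good.pair η _ (hden (b, i)) h2 ?_ hne
  exact Good.otherList (fun k => Rplus η (lam - wstring l Ns η ξ k)) B.reverse
    (by simpa using hB.1.2) (by simpa using hB.2.1) h

end helpers3

/-- With complete `ℓ`-string inhomogeneities, for `λ` avoiding
`w^{(ℓ)}_j − η` mod `πi`, the full spin-`ℓ/2` projector `P^{(ℓ)}_{1…L}` satisfies
`P X(λ) P = P X(λ)` for each monodromy entry `X ∈ {A,B,C,D}`; equivalently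
`(1⊗P) T^{(ℓ+;0)}(λ) (1⊗P) = (1⊗P) T^{(ℓ+;0)}(λ)` on `ℂ²₀ ⊗ (ℂ²)^{⊗L}`. -/
theorem proj_commutes_monodromy (ℓ Ns : ℕ) (hl : 1 ≤ ℓ) (hNs : 1 ≤ Ns)
    (η : ℂ) (ξ : Fin Ns → ℂ)
    (hroot : ∀ m : ℕ, 1 ≤ m → m ≤ ℓ → Complex.exp η ^ (2 * m) ≠ 1)
    (lam : ℂ) (hden : ∀ s : FSite ℓ Ns, Complex.sinh (lam - wstring ℓ Ns η ξ s + η) ≠ 0) :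
    (∀ a b : Fin 2,
      projFull (Complex.exp η) ℓ Ns *
          entryT (monodromy (Rplus η) (sitesList ℓ Ns) (wstring ℓ Ns η ξ) lam) a b *
          projFull (Complex.exp η) ℓ Ns
        = projFull (Complex.exp η) ℓ Ns *
            entryT (monodromy (Rplus η) (sitesList ℓ Ns) (wstring ℓ Ns η ξ) lam) a b)
    ∧ (let P2 : Matrix (Fin 2 × FIdx2 ℓ Ns) (Fin 2 × FIdx2 ℓ Ns) ℂ :=
         Matrix.of fun p p' =>
           (if p.1 = p'.1 then (1 : ℂ) else 0) * projFull (Complex.exp η) ℓ Ns p.2 p'.2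
       P2 * monodromy (Rplus η) (sitesList ℓ Ns) (wstring ℓ Ns η ξ) lam * P2
         = P2 * monodromy (Rplus η) (sitesList ℓ Ns) (wstring ℓ Ns η ξ) lam) := by
  have hq := Complex.exp_ne_zero η
  have main : (let P2 : Matrix (Fin 2 × FIdx2 ℓ Ns) (Fin 2 × FIdx2 ℓ Ns) ℂ :=
         Matrix.of fun p p' =>
           (if p.1 = p'.1 then (1 : ℂ) else 0) * projFull (Complex.exp η) ℓ Ns p.2 p'.2
       P2 * monodromy (Rplus η) (sitesList ℓ Ns) (wstring ℓ Ns η ξ) lam * P2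
         = P2 * monodromy (Rplus η) (sitesList ℓ Ns) (wstring ℓ Ns η ξ) lam) := by
    intro P2
    ext ⟨c, δ⟩ ⟨a, ε'⟩
    have hgood : ∀ (b : Fin Ns) (i j : Fin ℓ), j.val = i.val + 1 →
        Good (Complex.exp η) (b, i) (b, j)
          ((P2 * monodromy (Rplus η) (sitesList ℓ Ns) (wstring ℓ Ns η ξ) lam) (c, δ)) := by
      intro b i j hij
      have h1 := Good.monodromy η ξ lam hden b i j hij (projFull_row_good hq c δ b i j hij)
      exact h1
    rw [Matrix.mul_apply, Fintype.sum_prod_type,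
      ← Good.fixed hq hroot hgood a ε', Finset.sum_eq_single a]
    · simp [P2]
    · intro x _ hx
      simp [P2, hx]
    · simp
  refine ⟨fun a b => ?_, main⟩
  have hm := main
  simp only at hm
  ext δ ε'
  have h := congrFun (congrFun hm (a, δ)) (b, ε')
  simpa [Matrix.mul_apply, Fintype.sum_prod_type, entryT, ite_mul, Finset.sum_mul,
    Finset.mul_sum, Finset.sum_ite_eq] using h
end
end

section
/- Let η ∈ ℂ and w₁,…,w_L ∈ ℂ be arbitrary inhomogeneity parameters, and let T(λ) be the principal-grading (symmetric R-matrix) monodromy matrix with entries T_{a,b}(λ) (a,b ∈ {0,1}, so T_{0,0}=A, T_{0,1}=B, T_{1,0}=C, T_{1,1}=D). Then for all parameters μ₁,…,μ_{N+m}, λ₁,…,λ_M ∈ ℂ (such that all R-matrix denominators sinh(·+η) involved are nonzero) and all ε'_k, ε_k ∈ {0,1} (1 ≤ k ≤ m): ⟨1_∅| ∏_{α=1}^{N} C(μ_α) · T_{ε_1,ε'_1}(μ_{N+1}) ··· T_{ε_m,ε'_m}(μ_{N+m}) · ∏_{γ=1}^{M} B(λ_γ) |1_∅⟩ = ⟨1_∅|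 ∏_{β=1}^{M} C(λ_β) · T_{ε'_m,ε_m}(μ_{N+m}) ··· T_{ε'_1,ε_1}(μ_{N+1}) · ∏_{γ=1}^{N} B(μ_γ) |1_∅⟩. -/
noncomputable section

theorem ybe_scalar1 (x y η : ℂ) : Complex.sinh (x+η) * Complex.sinh (y+η) = Complex.sinh x * Complex.sinh y + Complex.sinh η * Complex.sinh (x+y+η) := by
  simp only [Complex.sinh_add, Complex.cosh_add]
  have h := Complex.cosh_sq_sub_sinh_sq η
  have h1 := Complex.cosh_sq_sub_sinh_sq x
  have h2 := Complex.cosh_sq_sub_sinh_sq y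
  linear_combination (Complex.sinh x * Complex.sinh y) * h

theorem ybe_scalar2 (x y η : ℂ) : Complex.sinh (x+η) * Complex.sinh (x+y) = Complex.sinh x * Complex.sinh (x+y+η) + Complex.sinh η * Complex.sinh y := by
  simp only [Complex.sinh_add, Complex.cosh_add]
  have h := Complex.cosh_sq_sub_sinh_sq η
  have h1 := Complex.cosh_sq_sub_sinh_sq x
  have h2 := Complex.cosh_sq_sub_sinh_sq y
  linear_combination (Complex.sinh η * Complex.sinh y) * h1

/-- Entries of the six-vertex R-matrix with weights `1, b, c`. -/
def R6 (b c : ℂ) (p p' : Fin 2 × Fin 2) : ℂ :=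
  match p, p' with
  | (0, 0), (0, 0) => 1
  | (1, 1), (1, 1) => 1
  | (0, 1), (0, 1) => b
  | (1, 0), (1, 0) => b
  | (0, 1), (1, 0) => c
  | (1, 0), (0, 1) => c
  | _, _ => 0

theorem Rprin_eq (η u : ℂ) (p p' : Fin 2 × Fin 2) :
    Rprin η u p p' = R6 (Complex.sinh u / Complex.sinh (u + η))
      (Complex.sinh η / Complex.sinh (u + η)) p p' := by
  obtain ⟨a, b⟩ := p
  obtain ⟨c, d⟩ := p'
  fin_cases a <;> fin_cases b <;> fin_cases c <;> fin_cases d <;> simp [Rprin, R6, bC]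

theorem R6_symm (b c : ℂ) (p p' : Fin 2 × Fin 2) : R6 b c p p' = R6 b c p' p := by
  obtain ⟨x, y⟩ := p
  obtain ⟨z, t⟩ := p'
  fin_cases x <;> fin_cases y <;> fin_cases z <;> fin_cases t <;> rfl

theorem Rprin_symm (η u : ℂ) (p p' : Fin 2 × Fin 2) : Rprin η u p p' = Rprin η u p' p := by
  rw [Rprin_eq, Rprin_eq, R6_symm]

set_option maxHeartbeats 2000000 in
theorem ybe6 (b1 c1 b2 c2 b3 c3 : ℂ)
    (h1 : c2 = b1 * c2 * b3 + c1 * c3)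
    (h2 : b2 * c3 = b1 * c3 + c1 * c2 * b3)
    (h3 : b2 * c1 = b3 * c1 + c3 * c2 * b1)
    (a b c a' b' c' : Fin 2) :
    ∑ p : Fin 2, ∑ q : Fin 2, ∑ r : Fin 2,
      R6 b1 c1 (a, b) (p, q) * R6 b2 c2 (p, c) (a', r) * R6 b3 c3 (q, r) (b', c')
    = ∑ p : Fin 2, ∑ q : Fin 2, ∑ r : Fin 2,
      R6 b3 c3 (b, c) (q, r) * R6 b2 c2 (a, r) (p, c') * R6 b1 c1 (p, q) (a', b') := by
  simp only [Fin.sum_univ_two]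
  fin_cases a <;> fin_cases b <;> fin_cases c <;> fin_cases a' <;> fin_cases b' <;> fin_cases c' <;>
    simp [R6] <;> first | ring1 | linear_combination h1 | linear_combination h2 | linear_combination h3 | linear_combination -h1 | linear_combination -h2 | linear_combination -h3

/-- Yang–Baxter equation in components. -/
theorem ybe (η x y z : ℂ) (hxy : z = x + y)
    (hx : Complex.sinh (x+η) ≠ 0) (hy : Complex.sinh (y+η) ≠ 0)
    (hz : Complex.sinh (z+η) ≠ 0) (a b c a' b' c' : Fin 2) :
    ∑ p : Fin 2, ∑ q : Fin 2, ∑ r : Fin 2,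
      Rprin η x (a, b) (p, q) * Rprin η z (p, c) (a', r) * Rprin η y (q, r) (b', c')
    = ∑ p : Fin 2, ∑ q : Fin 2, ∑ r : Fin 2,
      Rprin η y (b, c) (q, r) * Rprin η z (a, r) (p, c') * Rprin η x (p, q) (a', b') := by
  subst hxy
  have s1 := ybe_scalar1 x y η
  have s2 := ybe_scalar2 x y η
  have s3 := ybe_scalar2 y x η
  rw [add_comm y x] at s3
  simp only [Rprin_eq]
  apply ybe6
  · field_simp
    linear_combination Complex.sinh η * s1
  · field_simp
    linear_combination Complex.sinh η * s2
  · field_simp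
    linear_combination Complex.sinh η * s3

section algebra
variable {S : Type*} [DecidableEq S] [Fintype S]

/-- Kronecker delta on configurations. -/
def dlt (ε ε' : S → Fin 2) : ℂ := if ε = ε' then 1 else 0

/-- A `2×2` matrix acting on the site `j`. -/
def phi (j : S) (M : Matrix (Fin 2) (Fin 2) ℂ) : Matrix (S → Fin 2) (S → Fin 2) ℂ :=
  Matrix.of fun ε ε' => ∑ x, M (ε j) x * dlt (Function.update ε j x) ε'

/-- A `4×4` matrix acting on the sites `j, k`. -/
def psi (j k : S) (M : Matrix (Fin 2 × Fin 2) (Fin 2 × Fin 2) ℂ) :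
    Matrix (S → Fin 2) (S → Fin 2) ℂ :=
  Matrix.of fun ε ε' => ∑ x, ∑ y, M (ε j, ε k) (x, y) *
    dlt (Function.update (Function.update ε j x) k y) ε'

theorem phi_mul_apply (j : S) (M : Matrix (Fin 2) (Fin 2) ℂ)
    (A : Matrix (S → Fin 2) (S → Fin 2) ℂ) (ε ε' : S → Fin 2) :
    (phi j M * A) ε ε' = ∑ x, M (ε j) x * A (Function.update ε j x) ε' := by
  simp only [Matrix.mul_apply, phi, Matrix.of_apply, Finset.sum_mul]
  rw [Finset.sum_comm]
  refine Finset.sum_congr rfl fun x _ => ?_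
  simp [dlt]

theorem psi_mul_apply (j k : S) (M : Matrix (Fin 2 × Fin 2) (Fin 2 × Fin 2) ℂ)
    (A : Matrix (S → Fin 2) (S → Fin 2) ℂ) (ε ε' : S → Fin 2) :
    (psi j k M * A) ε ε' = ∑ x, ∑ y, M (ε j, ε k) (x, y) *
      A (Function.update (Function.update ε j x) k y) ε' := by
  simp only [Matrix.mul_apply, psi, Matrix.of_apply, Finset.sum_mul]
  rw [Finset.sum_comm]
  refine Finset.sum_congr rfl fun x _ => ?_
  rw [Finset.sum_comm]
  refine Finset.sum_congr rfl fun y _ => ?_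
  simp [dlt]

theorem phi_commute {j k : S} (h : j ≠ k) (M N : Matrix (Fin 2) (Fin 2) ℂ) :
    Commute (phi j M) (phi k N) := by
  ext ε ε'
  rw [phi_mul_apply, phi_mul_apply]
  simp only [phi, Matrix.of_apply, Finset.mul_sum]
  rw [Finset.sum_comm]
  refine Finset.sum_congr rfl fun x _ => Finset.sum_congr rfl fun y _ => ?_
  rw [Function.update_of_ne h.symm, Function.update_of_ne h, Function.update_comm h]
  ring

theorem psi_commute_phi {i j k : S} (hj : i ≠ j) (hk : i ≠ k)
    (M : Matrix (Fin 2 × Fin 2) (Fin 2 × Fin 2) ℂ) (N : Matrix (Fin 2) (Fin 2) ℂ) :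
    Commute (psi j k M) (phi i N) := by
  ext ε ε'
  rw [phi_mul_apply, psi_mul_apply]
  simp only [phi, psi, Matrix.of_apply, Finset.mul_sum]
  rw [Finset.sum_comm_cycle]
  refine Finset.sum_congr rfl fun x _ => Finset.sum_congr rfl fun y _ =>
    Finset.sum_congr rfl fun z _ => ?_
  rw [Function.update_of_ne hk, Function.update_of_ne hj, Function.update_of_ne hj.symm,
    Function.update_of_ne hk.symm, Function.update_comm hk.symm, Function.update_comm hj.symm]
  ring

theorem phi_mul_phi (j : S) (M N : Matrix (Fin 2) (Fin 2) ℂ) :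
    phi j M * phi j N = phi j (M * N) := by
  ext ε ε'
  rw [phi_mul_apply]
  simp only [phi, Matrix.of_apply, Finset.mul_sum, Matrix.mul_apply, Finset.sum_mul]
  rw [Finset.sum_comm]
  simp [mul_assoc]

theorem psi_mul_psi {j k : S} (h : j ≠ k) (M N : Matrix (Fin 2 × Fin 2) (Fin 2 × Fin 2) ℂ) :
    psi j k M * psi j k N = psi j k (M * N) := by
  ext ε ε'
  rw [psi_mul_apply]
  have key : ∀ x y x' y', Function.update (Function.update (Function.update (Function.update ε j x) k y) j x') k y'
      = Function.update (Function.update ε j x') k y' := by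
    intro x y x' y'
    rw [Function.update_comm h.symm, Function.update_idem, Function.update_idem]
  simp only [psi, Matrix.of_apply, Matrix.mul_apply, key, Function.update_self,
    Function.update_of_ne h, Fintype.sum_prod_type, Fin.sum_univ_two]
  ring

theorem phi_mul_phi' {j k : S} (h : j ≠ k) (M N : Matrix (Fin 2) (Fin 2) ℂ) :
    phi j M * phi k N = psi j k (Matrix.of fun p p' => M p.1 p'.1 * N p.2 p'.2) := by
  ext ε ε'
  rw [phi_mul_apply]
  simp only [phi, psi, Matrix.of_apply, Finset.mul_sum]
  refine Finset.sum_congr rfl fun x _ => Finset.sum_congr rfl fun y _ => ?_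
  rw [Function.update_of_ne h.symm]
  ring

theorem psi_add (j k : S) (M N : Matrix (Fin 2 × Fin 2) (Fin 2 × Fin 2) ℂ) :
    psi j k (M + N) = psi j k M + psi j k N := by
  ext ε ε'
  simp only [psi, Matrix.of_apply, Matrix.add_apply, add_mul, Finset.sum_add_distrib]

theorem phi_add (j : S) (M N : Matrix (Fin 2) (Fin 2) ℂ) :
    phi j (M + N) = phi j M + phi j N := by
  ext ε ε'
  simp only [phi, Matrix.of_apply, Matrix.add_apply, add_mul, Finset.sum_add_distrib]

theorem phi_smul (j : S) (c : ℂ) (M : Matrix (Fin 2) (Fin 2) ℂ) :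
    phi j (c • M) = c • phi j M := by
  ext ε ε'
  simp only [phi, Matrix.of_apply, Matrix.smul_apply, smul_eq_mul, Finset.mul_sum, mul_assoc]

/-- Blocks of a `4×4` matrix. -/
def blk (R2 : Matrix (Fin 2 × Fin 2) (Fin 2 × Fin 2) ℂ) (a b : Fin 2) : Matrix (Fin 2) (Fin 2) ℂ :=
  Matrix.of fun x y => R2 (a, x) (b, y)

theorem entryT_Rsite (R2 : Matrix (Fin 2 × Fin 2) (Fin 2 × Fin 2) ℂ) (j : S) (a b : Fin 2) :
    entryT (Rsite R2 j) a b = phi j (blk R2 a b) := by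
  ext ε ε'
  simp only [entryT, Rsite, phi, blk, Matrix.of_apply, dlt]
  split_ifs with h
  · have h' : ε' = Function.update ε j (ε' j) := by
      ext k
      by_cases hk : k = j
      · subst hk; simp
      · simp [hk, h k hk]
    rw [Finset.sum_eq_single (ε' j)]
    · rw [← h']; simp
    · intro x _ hx
      rw [if_neg, mul_zero]
      intro h2
      apply hx
      rw [← h2]; simp
    · simp
  · symm
    apply Finset.sum_eq_zero
    intro x _
    rw [if_neg, mul_zero]
    intro h2
    apply h
    intro k hk
    rw [← h2]; simp [hk]

theorem entryT_mul (X Y : Matrix (Fin 2 × (S → Fin 2)) (Fin 2 × (S → Fin 2)) ℂ) (a b : Fin 2) :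
    entryT (X * Y) a b = ∑ c, entryT X a c * entryT Y c b := by
  ext ε ε'
  simp [entryT, Matrix.mul_apply, Fintype.sum_prod_type]

theorem entryT_one (a b : Fin 2) :
    entryT (1 : Matrix (Fin 2 × (S → Fin 2)) (Fin 2 × (S → Fin 2)) ℂ) a b = if a = b then 1 else 0 := by
  ext ε ε'
  by_cases h : a = b <;> simp [entryT, Matrix.one_apply, h]

theorem monodromy_cons (R2 : ℂ → Matrix (Fin 2 × Fin 2) (Fin 2 × Fin 2) ℂ) (j : S) (l : List S)
    (w : S → ℂ) (lam : ℂ) :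
    monodromy R2 (j :: l) w lam = monodromy R2 l w lam * Rsite (R2 (lam - w j)) j := by
  simp [monodromy]

theorem monodromy_commute_of (R2 : ℂ → Matrix (Fin 2 × Fin 2) (Fin 2 × Fin 2) ℂ)
    (P : Matrix (S → Fin 2) (S → Fin 2) ℂ) (w : S → ℂ) (lam : ℂ) (l : List S)
    (hP : ∀ i ∈ l, ∀ M, Commute P (phi i M)) (a b : Fin 2) :
    Commute P (entryT (monodromy R2 l w lam) a b) := by
  induction l generalizing a b with
  | nil =>
    simp only [monodromy, List.map_nil, List.reverse_nil, List.prod_nil, entryT_one]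
    split_ifs
    · exact Commute.one_right _
    · exact Commute.zero_right _
  | cons k l ih =>
    rw [monodromy_cons, entryT_mul]
    refine Commute.sum_right _ _ _ fun c _ => ?_
    rw [entryT_Rsite]
    exact (ih (fun i hi => hP i (List.mem_cons_of_mem _ hi)) a c).mul_right
      (hP k List.mem_cons_self _)

theorem entryT_transpose (X : Matrix (Fin 2 × (S → Fin 2)) (Fin 2 × (S → Fin 2)) ℂ) (a b : Fin 2) :
    (entryT X a b).transpose = entryT X.transpose b a := by
  ext ε ε'
  simp [entryT]

theorem monodromy_transpose (η : ℂ) (l : List S) (w : S → ℂ) (lam : ℂ) :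
    (monodromy (Rprin η) l w lam).transpose = monodromy (Rprin η) l.reverse w lam := by
  have h : ∀ u (j : S), (Rsite (Rprin η u) j).transpose = Rsite (Rprin η u) j := by
    intro u j
    ext p p'
    simp only [Rsite, Matrix.transpose_apply, Matrix.of_apply]
    rw [Rprin_symm]
    simp only [eq_comm]
  rw [monodromy, monodromy, Matrix.transpose_list_prod]
  simp only [List.map_reverse, List.map_map, List.reverse_reverse, Function.comp_def, h]

/-- Swapping two adjacent sites. -/
theorem swap_rel (η : ℂ) {j k : S} (hjk : j ≠ k) (w : S → ℂ) (lam : ℂ)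
    (h1 : Complex.sinh (lam - w j + η) ≠ 0) (h2 : Complex.sinh (lam - w k + η) ≠ 0)
    (h3 : Complex.sinh (w j - w k + η) ≠ 0) (a b : Fin 2) :
    psi j k (Rprin η (w j - w k)) * entryT (Rsite (Rprin η (lam - w k)) k * Rsite (Rprin η (lam - w j)) j) a b
    = entryT (Rsite (Rprin η (lam - w j)) j * Rsite (Rprin η (lam - w k)) k) a b *
        psi j k (Rprin η (w j - w k)) := by
  have Y := ybe η (lam - w j) (w j - w k) (lam - w k) (by ring) h1 h3 h2
  simp only [entryT_mul, entryT_Rsite, Fin.sum_univ_two, (phi_commute hjk.symm _ _).eq,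
    phi_mul_phi' hjk, ← psi_add, psi_mul_psi hjk]
  congr 1
  ext ⟨x, y⟩ ⟨x', y'⟩
  have := Y a x y b x' y'
  simp only [Fin.sum_univ_two] at this
  simp only [Matrix.mul_apply, Fintype.sum_prod_type, Fin.sum_univ_two, blk, Matrix.of_apply,
    Matrix.add_apply]
  linear_combination -this

/-- Existence of an intertwiner between monodromy matrices for two orderings of the sites. -/
theorem perm_rel (η : ℂ) (w : S → ℂ) (h3 : ∀ j k, Complex.sinh (w j - w k + η) ≠ 0)
    {l l' : List S} (hp : l.Perm l') (hl : l.Nodup) :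
    ∃ P : Matrix (S → Fin 2) (S → Fin 2) ℂ,
      (∀ ε, P (fun _ => 0) ε = (1 : Matrix (S → Fin 2) (S → Fin 2) ℂ) (fun _ => 0) ε) ∧
      (∀ ε, P ε (fun _ => 0) = (1 : Matrix (S → Fin 2) (S → Fin 2) ℂ) ε (fun _ => 0)) ∧
      (∀ i, i ∉ l → ∀ M, Commute P (phi i M)) ∧
      ∀ lam, (∀ j, Complex.sinh (lam - w j + η) ≠ 0) → ∀ a b,
        P * entryT (monodromy (Rprin η) l w lam) a b = entryT (monodromy (Rprin η) l' w lam) a b * P := by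
  induction hp with
  | nil => exact ⟨1, by simp, by simp, by simp, by simp⟩
  | @cons x l1 l2 hp ih =>
    obtain ⟨P, e1, e2, hc, hr⟩ := ih (List.nodup_cons.1 hl).2
    refine ⟨P, e1, e2, fun i hi => hc i fun h => hi (List.mem_cons_of_mem _ h), ?_⟩
    intro lam hlam a b
    rw [monodromy_cons, monodromy_cons, entryT_mul, entryT_mul, Finset.mul_sum, Finset.sum_mul]
    refine Finset.sum_congr rfl fun c _ => ?_
    rw [← mul_assoc, hr lam hlam, mul_assoc, mul_assoc, entryT_Rsite,
      (hc x (List.nodup_cons.1 hl).1 _).eq]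
  | swap j k l =>
    -- `k :: j :: l` versus `j :: k :: l`
    have hkj : k ≠ j := by
      intro h; subst h; simp at hl
    have hkl : k ∉ l := fun h => (List.nodup_cons.1 hl).1 (List.mem_cons_of_mem _ h)
    have hjl : j ∉ l := (List.nodup_cons.1 (List.nodup_cons.1 hl).2).1
    refine ⟨psi k j (Rprin η (w k - w j)), ?_, ?_, ?_, ?_⟩
    · intro ε
      simp [psi, Rprin_eq, R6, Matrix.one_apply, dlt]
    · intro ε
      have hz : Function.update (Function.update ε k 0) j 0 = (fun _ => 0) ∧ ε k = 0 ∧ ε j = 0 ↔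
          ε = fun _ => 0 := by
        constructor
        · rintro ⟨h, h1, h2⟩
          have e1 : Function.update ε k 0 = ε := by
            rw [Function.update_eq_self_iff, h1]
          have e2 : Function.update ε j 0 = ε := by
            rw [Function.update_eq_self_iff, h2]
          rwa [e1, e2] at h
        · rintro rfl
          simp
      have hn : ∀ x y, ¬ (x = 0 ∧ y = 0) →
          Function.update (Function.update ε k x) j y ≠ (fun _ => 0) := by
        intro x y hxy h
        apply hxy
        have h1 := congrFun h k
        have h2 := congrFun h j
        simp [hkj] at h1 h2
        exact ⟨h1, h2⟩
      simp only [psi, Matrix.of_apply, Fin.sum_univ_two, dlt, Matrix.one_apply]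
      rw [if_neg (hn 0 1 (by simp)), if_neg (hn 1 0 (by simp)), if_neg (hn 1 1 (by simp)), Rprin_eq]
      rw [← if_congr hz rfl rfl]
      generalize ε k = x
      generalize ε j = y
      fin_cases x <;> fin_cases y <;> simp [R6]
    · intro i hi M
      simp only [List.mem_cons, not_or] at hi
      exact psi_commute_phi hi.1 hi.2.1 _ _
    · intro lam hlam a b
      simp only [monodromy_cons, mul_assoc]
      rw [entryT_mul, entryT_mul (monodromy (Rprin η) l w lam), Finset.mul_sum, Finset.sum_mul]
      refine Finset.sum_congr rfl fun c _ => ?_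
      have hcomm : Commute (psi k j (Rprin η (w k - w j))) (entryT (monodromy (Rprin η) l w lam) a c) := by
        exact monodromy_commute_of _ _ w lam l
          (fun i hi M => psi_commute_phi (ne_of_mem_of_not_mem hi hkl) (ne_of_mem_of_not_mem hi hjl) _ _) a c
      rw [← mul_assoc, hcomm.eq, mul_assoc, swap_rel η hkj w lam (hlam k) (hlam j) (h3 k j), mul_assoc]
  | @trans l1 l2 l3 hp1 hp2 ih1 ih2 =>
    obtain ⟨P, e1, e2, hc, hr⟩ := ih1 hl
    obtain ⟨Q, f1, f2, hd, hs⟩ := ih2 (hp1.nodup_iff.1 hl)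
    refine ⟨Q * P, ?_, ?_, ?_, ?_⟩
    · intro ε
      simp [Matrix.mul_apply, f1, Matrix.one_apply, e1]
    · intro ε
      simp [Matrix.mul_apply, f2, Matrix.one_apply, e2]
    · intro i hi M
      exact (hd i (fun h => hi (hp1.mem_iff.2 h)) M).mul_left (hc i hi M)
    · intro lam hlam a b
      rw [mul_assoc, hr lam hlam, ← mul_assoc, hs lam hlam, mul_assoc]

end algebra

section rtt
variable {A : Type*} [Ring A] [Algebra ℂ A]

/-- `X ⊗ 1` on the doubled auxiliary space. -/
def lift1 (X : Fin 2 → Fin 2 → A) : Matrix (Fin 2 × Fin 2) (Fin 2 × Fin 2) A :=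
  Matrix.of fun p p' => if p.2 = p'.2 then X p.1 p'.1 else 0

/-- `1 ⊗ X` on the doubled auxiliary space. -/
def lift2 (X : Fin 2 → Fin 2 → A) : Matrix (Fin 2 × Fin 2) (Fin 2 × Fin 2) A :=
  Matrix.of fun p p' => if p.1 = p'.1 then X p.2 p'.2 else 0

/-- A scalar matrix with entries mapped into `A`. -/
def scal (R : Matrix (Fin 2 × Fin 2) (Fin 2 × Fin 2) ℂ) : Matrix (Fin 2 × Fin 2) (Fin 2 × Fin 2) A :=
  Matrix.of fun p p' => algebraMap ℂ A (R p p')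

theorem lift1_mul (X Y : Fin 2 → Fin 2 → A) :
    lift1 (fun a b => ∑ c, X a c * Y c b) = lift1 X * lift1 Y := by
  ext ⟨a, b⟩ ⟨c, d⟩
  by_cases h : b = d <;>
  simp [lift1, Matrix.mul_apply, Fintype.sum_prod_type, h]

theorem lift2_mul (X Y : Fin 2 → Fin 2 → A) :
    lift2 (fun a b => ∑ c, X a c * Y c b) = lift2 X * lift2 Y := by
  ext ⟨a, b⟩ ⟨c, d⟩
  by_cases h : a = c <;>
  simp [lift2, Matrix.mul_apply, Fintype.sum_prod_type, h, -Fin.sum_univ_two]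

theorem lift_commute (X Y : Fin 2 → Fin 2 → A) (h : ∀ a b c d, Commute (X a b) (Y c d)) :
    lift1 X * lift2 Y = lift2 Y * lift1 X := by
  ext ⟨a, b⟩ ⟨c, d⟩
  simp [lift1, lift2, Matrix.mul_apply, Fintype.sum_prod_type, -Fin.sum_univ_two, (h _ _ _ _).eq]

/-- The RTT relation. -/
def RTT (R : Matrix (Fin 2 × Fin 2) (Fin 2 × Fin 2) ℂ) (X Y : Fin 2 → Fin 2 → A) : Prop :=
  scal R * lift1 X * lift2 Y = lift2 Y * lift1 X * scal R

theorem RTT_mul {R : Matrix (Fin 2 × Fin 2) (Fin 2 × Fin 2) ℂ} {X Y X' Y' : Fin 2 → Fin 2 → A}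
    (h : RTT R X Y) (h' : RTT R X' Y') (hc : ∀ a b c d, Commute (X' a b) (Y c d))
    (hc' : ∀ a b c d, Commute (X a b) (Y' c d)) :
    RTT R (fun a b => ∑ c, X a c * X' c b) (fun a b => ∑ c, Y a c * Y' c b) := by
  unfold RTT at *
  rw [lift1_mul, lift2_mul]
  have k1 := lift_commute X' Y hc
  have k2 := lift_commute X Y' hc'
  calc scal R * (lift1 X * lift1 X') * (lift2 Y * lift2 Y')
      = scal R * lift1 X * (lift1 X' * lift2 Y) * lift2 Y' := by simp only [mul_assoc]
    _ = (scal R * lift1 X * lift2 Y) * lift1 X' * lift2 Y' := by rw [k1]; simp only [mul_assoc]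
    _ = lift2 Y * lift1 X * (scal R * lift1 X' * lift2 Y') := by rw [h]; simp only [mul_assoc]
    _ = lift2 Y * (lift1 X * lift2 Y') * lift1 X' * scal R := by rw [h']; simp only [mul_assoc]
    _ = _ := by rw [k2]; simp only [mul_assoc]

theorem RTT_comp {R : Matrix (Fin 2 × Fin 2) (Fin 2 × Fin 2) ℂ} {X Y : Fin 2 → Fin 2 → A} :
    RTT R X Y ↔ ∀ a b c d, ∑ p, ∑ q, R (a, b) (p, q) • (X p c * Y q d) =
      ∑ p, ∑ q, R (p, q) (c, d) • (Y b q * X a p) := by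
  have e1 : ∀ a b c d, (scal R * lift1 X * lift2 Y : Matrix (Fin 2 × Fin 2) (Fin 2 × Fin 2) A) (a, b) (c, d) =
      ∑ p, ∑ q, R (a, b) (p, q) • (X p c * Y q d) := by
    intro a b c d
    fin_cases c <;> simp [mul_assoc, Matrix.mul_apply, Fintype.sum_prod_type, lift1, lift2, scal, Algebra.smul_def, mul_add, add_mul] <;> abel
  have e2 : ∀ a b c d, (lift2 Y * lift1 X * scal R : Matrix (Fin 2 × Fin 2) (Fin 2 × Fin 2) A) (a, b) (c, d) =
      ∑ p, ∑ q, R (p, q) (c, d) • (Y b q * X a p) := by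
    intro a b c d
    fin_cases a <;> simp [Matrix.mul_apply, Fintype.sum_prod_type, lift1, lift2, scal, ← Algebra.commutes, Algebra.smul_def, mul_add, add_mul] <;> abel
  constructor
  · intro h a b c d
    rw [← e1, ← e2, h]
  · intro h
    ext ⟨a, b⟩ ⟨c, d⟩
    rw [e1, e2, h]

end rtt

section mono
variable {S : Type*} [DecidableEq S] [Fintype S]

theorem RTT_site (η : ℂ) (x y u : ℂ) (j : S) (h1 : Complex.sinh (x - u + η) ≠ 0)
    (h2 : Complex.sinh (y - u + η) ≠ 0) (h3 : Complex.sinh (x - y + η) ≠ 0) :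
    RTT (Rprin η (x - y)) (entryT (Rsite (Rprin η (x - u)) j)) (entryT (Rsite (Rprin η (y - u)) j)) := by
  rw [RTT_comp]
  intro a b c d
  have Y := ybe η (x - y) (y - u) (x - u) (by ring) h3 h2 h1
  simp only [entryT_Rsite, phi_mul_phi, ← phi_smul, Fin.sum_univ_two, ← phi_add]
  congr 1
  ext s t
  have := Y a b s c d t
  simp only [Fin.sum_univ_two] at this
  simp only [Matrix.mul_apply, Fin.sum_univ_two, blk, Matrix.of_apply,
    Matrix.add_apply, Matrix.smul_apply, smul_eq_mul]
  linear_combination this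

theorem RTT_monodromy (η : ℂ) (x y : ℂ) (w : S → ℂ) (h1 : ∀ j, Complex.sinh (x - w j + η) ≠ 0)
    (h2 : ∀ j, Complex.sinh (y - w j + η) ≠ 0) (h3 : Complex.sinh (x - y + η) ≠ 0)
    (l : List S) (hl : l.Nodup) :
    RTT (Rprin η (x - y)) (entryT (monodromy (Rprin η) l w x)) (entryT (monodromy (Rprin η) l w y)) := by
  induction l with
  | nil =>
    rw [RTT_comp]
    intro a b c d
    have h : entryT (monodromy (Rprin η) ([] : List S) w x) = fun a b => if a = b then 1 else 0 := by
      ext1 a; ext1 b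
      simp only [monodromy, List.map_nil, List.reverse_nil, List.prod_nil, entryT_one]
    have h' : entryT (monodromy (Rprin η) ([] : List S) w y) = fun a b => if a = b then 1 else 0 := by
      ext1 a; ext1 b
      simp only [monodromy, List.map_nil, List.reverse_nil, List.prod_nil, entryT_one]
    simp only [h, h']
    simp [-Fin.sum_univ_two, Rprin_eq]
  | cons j l ih =>
    rw [List.nodup_cons] at hl
    have hx : ∀ z, entryT (monodromy (Rprin η) (j :: l) w z) = fun a b => ∑ c,
        entryT (monodromy (Rprin η) l w z) a c * entryT (Rsite (Rprin η (z - w j)) j) c b := by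
      intro z
      ext1 a; ext1 b
      rw [monodromy_cons, entryT_mul]
    have hcom : ∀ z z' a b c d, Commute (entryT (Rsite (Rprin η (z - w j)) j) a b)
        (entryT (monodromy (Rprin η) l w z') c d) := by
      intro z z' a b c d
      rw [entryT_Rsite]
      exact monodromy_commute_of _ _ w z' l
        (fun i hi M => phi_commute (ne_of_mem_of_not_mem hi hl.1).symm _ _) c d
    rw [hx, hx]
    exact RTT_mul (ih hl.2) (RTT_site η x y (w j) j (h1 j) (h2 j) h3)
      (hcom x y) (fun a b c d => (hcom y x c d a b).symm)

theorem BB_commute (η : ℂ) (x y : ℂ) (w : S → ℂ) (h1 : ∀ j, Complex.sinh (x - w j + η) ≠ 0)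
    (h2 : ∀ j, Complex.sinh (y - w j + η) ≠ 0) (h3 : Complex.sinh (x - y + η) ≠ 0)
    (l : List S) (hl : l.Nodup) (a b : Fin 2) (hab : a ≠ b) :
    Commute (entryT (monodromy (Rprin η) l w x) a b) (entryT (monodromy (Rprin η) l w y) a b) := by
  have h := RTT_comp.1 (RTT_monodromy η x y w h1 h2 h3 l hl) a a b b
  fin_cases a <;> fin_cases b <;> simp [Rprin_eq, R6] at h hab ⊢ <;> exact h

end mono

section final
open Filter Topology

theorem semiconj_list {A ι : Type*} [Monoid A] (P : A) (f g : ι → A)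
    (h : ∀ i, SemiconjBy P (f i) (g i)) (l : List ι) :
    SemiconjBy P (l.map f).prod (l.map g).prod := by
  induction l with
  | nil => simp
  | cons i l ih =>
    rw [List.map_cons, List.map_cons, List.prod_cons, List.prod_cons]
    exact (h i).mul_right ih

theorem sinh_eventually (d η : ℂ) : ∀ᶠ z in 𝓝[≠] η, Complex.sinh (d + z) ≠ 0 := by
  by_cases h : Complex.sinh (d + η) = 0
  · have hd : HasDerivAt (fun z => Complex.sinh (d + z)) (Complex.cosh (d + η)) η := by
      have := ((hasDerivAt_id η).const_add d).csinh
      simpa using this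
    refine hd.eventually_ne ?_
    intro hc
    have := Complex.cosh_sq_sub_sinh_sq (d + η)
    rw [h, hc] at this
    norm_num at this
  · have : ContinuousAt (fun z => Complex.sinh (d + z)) η := by fun_prop
    exact (this.eventually_ne h).filter_mono nhdsWithin_le_nhds

theorem tendsto_entry {L : ℕ} (η : ℂ) (w : Fin L → ℂ) (x : ℂ)
    (h : ∀ j, Complex.sinh (x - w j + η) ≠ 0) (l : List (Fin L)) (a b : Fin 2) :
    Tendsto (fun z => entryT (monodromy (Rprin z) l w x) a b) (𝓝 η)
      (𝓝 (entryT (monodromy (Rprin η) l w x) a b)) := by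
  have h1 : Tendsto (fun z => monodromy (Rprin z) l w x) (𝓝 η) (𝓝 (monodromy (Rprin η) l w x)) := by
    simp only [monodromy, ← List.map_reverse]
    refine tendsto_list_prod _ fun j _ => ?_
    refine tendsto_pi_nhds.2 fun p => tendsto_pi_nhds.2 fun p' => ?_
    simp only [Rsite, Matrix.of_apply]
    split_ifs
    · simp only [Rprin, bC, Matrix.of_apply]
      have hs : Tendsto (fun z => Complex.sinh (x - w j + z)) (𝓝 η) (𝓝 (Complex.sinh (x - w j + η))) := by
        have : ContinuousAt (fun z => Complex.sinh (x - w j + z)) η := by fun_prop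
        exact this
      have hs' : Tendsto (fun z => Complex.sinh z) (𝓝 η) (𝓝 (Complex.sinh η)) := by
        have : ContinuousAt (fun z => Complex.sinh z) η := by fun_prop
        exact this
      split_ifs
      · exact tendsto_const_nhds
      · exact tendsto_const_nhds.div hs (h j)
      · exact hs'.div hs (h j)
      · exact tendsto_const_nhds
    · exact tendsto_const_nhds
  refine tendsto_pi_nhds.2 fun p => tendsto_pi_nhds.2 fun p' => ?_
  exact (tendsto_pi_nhds.1 (tendsto_pi_nhds.1 h1 (a, p)) (b, p'))

theorem exchange_generic (L N m M : ℕ) (η : ℂ) (w : Fin L → ℂ)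
    (μ : Fin (N + m) → ℂ) (lam : Fin M → ℂ)
    (hdμ : ∀ (α : Fin (N + m)) (j : Fin L), Complex.sinh (μ α - w j + η) ≠ 0)
    (hdlam : ∀ (γ : Fin M) (j : Fin L), Complex.sinh (lam γ - w j + η) ≠ 0)
    (hw : ∀ j k, Complex.sinh (w j - w k + η) ≠ 0)
    (hμ : ∀ j k, Complex.sinh (μ j - μ k + η) ≠ 0)
    (hlam : ∀ j k, Complex.sinh (lam j - lam k + η) ≠ 0)
    (e' e : Fin m → Fin 2) :
    ((List.ofFn fun α : Fin N =>
        entryT (monodromy (Rprin η) (List.finRange L) w (μ (Fin.castAdd m α))) 1 0).prod *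
      (List.ofFn fun k : Fin m =>
        entryT (monodromy (Rprin η) (List.finRange L) w (μ (Fin.natAdd N k))) (e k) (e' k)).prod *
      (List.ofFn fun γ : Fin M =>
        entryT (monodromy (Rprin η) (List.finRange L) w (lam γ)) 0 1).prod)
      (fun _ => 0) (fun _ => 0)
    = ((List.ofFn fun β : Fin M =>
          entryT (monodromy (Rprin η) (List.finRange L) w (lam β)) 1 0).prod *
        ((List.ofFn fun k : Fin m =>
          entryT (monodromy (Rprin η) (List.finRange L) w (μ (Fin.natAdd N k))) (e' k) (e k)).reverse).prod *
        (List.ofFn fun γ : Fin N =>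
          entryT (monodromy (Rprin η) (List.finRange L) w (μ (Fin.castAdd m γ))) 0 1).prod)
        (fun _ => 0) (fun _ => 0) := by
  have hnd := List.nodup_finRange L
  have hB : (List.ofFn fun γ : Fin N =>
          entryT (monodromy (Rprin η) (List.finRange L) w (μ (Fin.castAdd m γ))) 0 1).prod =
      (List.ofFn fun γ : Fin N =>
          entryT (monodromy (Rprin η) (List.finRange L) w (μ (Fin.castAdd m γ))) 0 1).reverse.prod := by
    refine List.Perm.prod_eq' (List.reverse_perm _).symm ?_
    rw [List.pairwise_ofFn]
    intro i j _
    exact BB_commute η _ _ w (hdμ _) (hdμ _) (hμ _ _) _ hnd 0 1 (by simp)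
  have hC : (List.ofFn fun β : Fin M =>
          entryT (monodromy (Rprin η) (List.finRange L) w (lam β)) 1 0).prod =
      (List.ofFn fun β : Fin M =>
          entryT (monodromy (Rprin η) (List.finRange L) w (lam β)) 1 0).reverse.prod := by
    refine List.Perm.prod_eq' (List.reverse_perm _).symm ?_
    rw [List.pairwise_ofFn]
    intro i j _
    exact BB_commute η _ _ w (hdlam _) (hdlam _) (hlam _ _) _ hnd 1 0 (by simp)
  rw [hB, hC]
  obtain ⟨P, e1, e2, -, hr⟩ := perm_rel η w hw (List.reverse_perm (List.finRange L))
    (List.nodup_reverse.2 hnd)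
  rw [← Matrix.transpose_apply (_ * _)]
  simp only [List.ofFn_eq_map, ← List.map_reverse, Matrix.transpose_mul, Matrix.transpose_list_prod,
    List.map_map, Function.comp_def, entryT_transpose, monodromy_transpose, ← mul_assoc]
  generalize hX : (_ * _ * _ : Matrix (Fin L → Fin 2) (Fin L → Fin 2) ℂ) = X
  generalize hY : (_ * _ * _ : Matrix (Fin L → Fin 2) (Fin L → Fin 2) ℂ) = Y
  have key : SemiconjBy P X Y := by
    rw [← hX, ← hY]
    refine SemiconjBy.mul_right (SemiconjBy.mul_right ?_ ?_) ?_
    · exact semiconj_list P _ _ (fun i => hr _ (hdlam _) _ _) _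
    · exact semiconj_list P _ _ (fun i => hr _ (hdμ _) _ _) _
    · exact semiconj_list P _ _ (fun i => hr _ (hdμ _) _ _) _
  have h1 : (P * X) (fun _ => 0) (fun _ => 0) = X (fun _ => 0) (fun _ => 0) := by
    simp [Matrix.mul_apply, e1, Matrix.one_apply]
  have h2 : (Y * P) (fun _ => 0) (fun _ => 0) = Y (fun _ => 0) (fun _ => 0) := by
    simp [Matrix.mul_apply, e2, Matrix.one_apply]
  rw [← h1, ← h2, key.eq]

end final

/-- For the principal-grading (symmetric R-matrix) monodromy matrix
with arbitrary inhomogeneities, setting `μ_{N+k}` as the arguments of the middle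
operators,
`⟨1_∅| ∏_{α≤N} C(μ_α) T_{ε_1,ε'_1}(μ_{N+1}) ⋯ T_{ε_m,ε'_m}(μ_{N+m}) ∏_{γ≤M} B(λ_γ) |1_∅⟩
 = ⟨1_∅| ∏_{β≤M} C(λ_β) T_{ε'_m,ε_m}(μ_{N+m}) ⋯ T_{ε'_1,ε_1}(μ_{N+1}) ∏_{γ≤N} B(μ_γ) |1_∅⟩`. -/
theorem exchange_formula (L N m M : ℕ) (η : ℂ) (w : Fin L → ℂ)
    (μ : Fin (N + m) → ℂ) (lam : Fin M → ℂ)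
    (hdμ : ∀ (α : Fin (N + m)) (j : Fin L), Complex.sinh (μ α - w j + η) ≠ 0)
    (hdlam : ∀ (γ : Fin M) (j : Fin L), Complex.sinh (lam γ - w j + η) ≠ 0)
    (e' e : Fin m → Fin 2) :
    ((List.ofFn fun α : Fin N =>
        entryT (monodromy (Rprin η) (List.finRange L) w (μ (Fin.castAdd m α))) 1 0).prod *
      (List.ofFn fun k : Fin m =>
        entryT (monodromy (Rprin η) (List.finRange L) w (μ (Fin.natAdd N k))) (e k) (e' k)).prod *
      (List.ofFn fun γ : Fin M =>
        entryT (monodromy (Rprin η) (List.finRange L) w (lam γ)) 0 1).prod)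
      (fun _ => 0) (fun _ => 0)
    = ((List.ofFn fun β : Fin M =>
          entryT (monodromy (Rprin η) (List.finRange L) w (lam β)) 1 0).prod *
        ((List.ofFn fun k : Fin m =>
          entryT (monodromy (Rprin η) (List.finRange L) w (μ (Fin.natAdd N k))) (e' k) (e k)).reverse).prod *
        (List.ofFn fun γ : Fin N =>
          entryT (monodromy (Rprin η) (List.finRange L) w (μ (Fin.castAdd m γ))) 0 1).prod)
        (fun _ => 0) (fun _ => 0) := by
  have tprod : ∀ (K : ℕ) (x : Fin K → ℂ) (a b : Fin K → Fin 2)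
      (_ : ∀ i j, Complex.sinh (x i - w j + η) ≠ 0) (l : List (Fin K)),
      Filter.Tendsto (fun z => (l.map fun i =>
        entryT (monodromy (Rprin z) (List.finRange L) w (x i)) (a i) (b i)).prod) (nhds η)
        (nhds (l.map fun i =>
          entryT (monodromy (Rprin η) (List.finRange L) w (x i)) (a i) (b i)).prod) := by
    intro K x a b hx l
    exact tendsto_list_prod l fun i _ => tendsto_entry η w (x i) (hx i) _ _ _
  have hgen : ∀ᶠ z in nhdsWithin η {η}ᶜ,
      (∀ (α : Fin (N + m)) (j : Fin L), Complex.sinh (μ α - w j + z) ≠ 0) ∧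
      (∀ (γ : Fin M) (j : Fin L), Complex.sinh (lam γ - w j + z) ≠ 0) ∧
      (∀ j k, Complex.sinh (w j - w k + z) ≠ 0) ∧
      (∀ j k, Complex.sinh (μ j - μ k + z) ≠ 0) ∧
      (∀ j k, Complex.sinh (lam j - lam k + z) ≠ 0) := by
    simp only [Filter.eventually_and, Filter.eventually_all]
    exact ⟨fun _ _ => sinh_eventually _ _, fun _ _ => sinh_eventually _ _,
      fun _ _ => sinh_eventually _ _, fun _ _ => sinh_eventually _ _,
      fun _ _ => sinh_eventually _ _⟩
  have hEq := hgen.mono fun z hz => exchange_generic L N m M z w μ lam hz.1 hz.2.1 hz.2.2.1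
    hz.2.2.2.1 hz.2.2.2.2 e' e
  simp only [List.ofFn_eq_map, ← List.map_reverse] at hEq ⊢
  have hL := ((tprod N (fun α => μ (Fin.castAdd m α)) (fun _ => 1) (fun _ => 0)
      (fun i => hdμ _) (List.finRange N)).mul
    (tprod m (fun k => μ (Fin.natAdd N k)) e e' (fun i => hdμ _) (List.finRange m))).mul
    (tprod M lam (fun _ => 0) (fun _ => 1) hdlam (List.finRange M))
  have hR := ((tprod M lam (fun _ => 1) (fun _ => 0) hdlam (List.finRange M)).mul
    (tprod m (fun k => μ (Fin.natAdd N k)) e' e (fun i => hdμ _) (List.finRange m).reverse)).mul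
    (tprod N (fun α => μ (Fin.castAdd m α)) (fun _ => 0) (fun _ => 1)
      (fun i => hdμ _) (List.finRange N))
  have hL' := (tendsto_pi_nhds.1 (tendsto_pi_nhds.1 hL (fun _ => 0)) (fun _ => 0)).mono_left
    (nhdsWithin_le_nhds (s := {η}ᶜ))
  have hR' := (tendsto_pi_nhds.1 (tendsto_pi_nhds.1 hR (fun _ => 0)) (fun _ => 0)).mono_left
    (nhdsWithin_le_nhds (s := {η}ᶜ))
  exact tendsto_nhds_unique_of_eventuallyEq hL' hR' hEq
end
end
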